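/- arXiv:2304.10344 — 4 statements merged into one kernel-verified Lean document; each statement's English description precedes it below -/
import Mathlib

section
/- Assume 0 < α < r, and let δ, β, E, x > 0, p ≥ 0 and π ∈ [0,1]. Define θ := 2α(2r+δ)/((r−α)(r+α)(r+δ−α)(r+δ+α)), θ₀ := 2α/((r+δ−α)(r+δ+α)), ρ := 1/((r+δ+α)(r+α)) and ρ₀ := 1/(r+δ+α). Then the function t ↦ e^{−rt}·x·(π·e^{αt} + (1−π)·e^{−αt})·((βE/δ)·(1−e^{−δt}) + p·e^{−δt}) is integrable on [0,∞) and ∫₀^∞ e^{−rt}·x·(π·e^{αt} + (1−π)·e^{−αt})·((βE/δ)·(1−e^{−δt}) + p·e^{−δt}) dt = βE·x·(θπ + ρ) + x·p·(θ₀π + ρ₀). -/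
open MeasureTheory

theorem integrableOn_Ici_exp_neg_mul {a : ℝ} (ha : 0 < a) :
    IntegrableOn (fun t : ℝ => Real.exp (-a * t)) (Set.Ici 0) volume :=
  Iff.mpr integrableOn_Ici_iff_integrableOn_Ioi
    (integrableOn_exp_mul_Ioi (neg_lt_zero.mpr ha) 0)

theorem integral_Ici_exp_neg_mul {a : ℝ} (ha : 0 < a) :
    ∫ t in Set.Ici (0 : ℝ), Real.exp (-a * t) = 1 / a := by
  rw [integral_Ici_eq_integral_Ioi, integral_exp_mul_Ioi (neg_lt_zero.mpr ha)]
  simp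

/-- The expected total discounted cost of never adopting the policy: for `0 < α < r`,
`∫₀^∞ e^{−rt} x (π e^{αt} + (1−π)e^{−αt}) ((βE/δ)(1−e^{−δt}) + p e^{−δt}) dt
  = βE x (θπ + ρ) + x p (θ₀π + ρ₀)`. -/
theorem value_never_adopt (r α δ β E x p π : ℝ)
    (hα : 0 < α) (hαr : α < r) (hδ : 0 < δ) (hβ : 0 < β) (hE : 0 < E)
    (hx : 0 < x) (hp : 0 ≤ p) (hπ : π ∈ Set.Icc (0 : ℝ) 1)
    (θ θ₀ ρ ρ₀ : ℝ)
    (hθ : θ = 2 * α * (2 * r + δ) / ((r - α) * (r + α) * (r + δ - α) * (r + δ + α)))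
    (hθ₀ : θ₀ = 2 * α / ((r + δ - α) * (r + δ + α)))
    (hρ : ρ = 1 / ((r + δ + α) * (r + α)))
    (hρ₀ : ρ₀ = 1 / (r + δ + α)) :
    IntegrableOn
      (fun t : ℝ => Real.exp (-r * t) * x * (π * Real.exp (α * t) + (1 - π) * Real.exp (-α * t))
        * ((β * E / δ) * (1 - Real.exp (-δ * t)) + p * Real.exp (-δ * t)))
      (Set.Ici 0) volume
    ∧ ∫ t in Set.Ici (0 : ℝ),
        Real.exp (-r * t) * x * (π * Real.exp (α * t) + (1 - π) * Real.exp (-α * t))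
        * ((β * E / δ) * (1 - Real.exp (-δ * t)) + p * Real.exp (-δ * t))
      = β * E * x * (θ * π + ρ) + x * p * (θ₀ * π + ρ₀) := by
  have h₁ : 0 < r - α := sub_pos.mpr hαr
  have h₂ : 0 < r + α := by linarith
  have h₃ : 0 < r + δ - α := by linarith
  have h₄ : 0 < r + δ + α := by linarith
  have expand : (fun t : ℝ => Real.exp (-r * t) * x
        * (π * Real.exp (α * t) + (1 - π) * Real.exp (-α * t))
        * ((β * E / δ) * (1 - Real.exp (-δ * t)) + p * Real.exp (-δ * t)))
      = fun t : ℝ => x * π * (β * E / δ) * Real.exp (-(r - α) * t)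
        + x * (1 - π) * (β * E / δ) * Real.exp (-(r + α) * t)
        + x * π * (p - β * E / δ) * Real.exp (-(r + δ - α) * t)
        + x * (1 - π) * (p - β * E / δ) * Real.exp (-(r + δ + α) * t) := by
    funext t
    have e₁ : Real.exp (-(r - α) * t) = Real.exp (-r * t) * Real.exp (α * t) := by
      rw [← Real.exp_add]; ring_nf
    have e₂ : Real.exp (-(r + α) * t) = Real.exp (-r * t) * Real.exp (-α * t) := by
      rw [← Real.exp_add]; ring_nf
    have e₃ : Real.exp (-(r + δ - α) * t)
        = Real.exp (-r * t) * Real.exp (α * t) * Real.exp (-δ * t) := by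
      rw [← Real.exp_add, ← Real.exp_add]; ring_nf
    have e₄ : Real.exp (-(r + δ + α) * t)
        = Real.exp (-r * t) * Real.exp (-α * t) * Real.exp (-δ * t) := by
      rw [← Real.exp_add, ← Real.exp_add]; ring_nf
    rw [e₁, e₂, e₃, e₄]
    ring
  have i₁ := (integrableOn_Ici_exp_neg_mul h₁).const_mul (x * π * (β * E / δ))
  have i₂ := (integrableOn_Ici_exp_neg_mul h₂).const_mul (x * (1 - π) * (β * E / δ))
  have i₃ := (integrableOn_Ici_exp_neg_mul h₃).const_mul (x * π * (p - β * E / δ))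
  have i₄ := (integrableOn_Ici_exp_neg_mul h₄).const_mul (x * (1 - π) * (p - β * E / δ))
  rw [expand]
  have i₁₂ := i₁.fun_add i₂
  have i₁₂₃ := i₁₂.fun_add i₃
  refine ⟨i₁₂₃.fun_add i₄, ?_⟩
  rw [integral_add i₁₂₃ i₄, integral_add i₁₂ i₃, integral_add i₁ i₂]
  simp only [integral_const_mul, integral_Ici_exp_neg_mul h₁, integral_Ici_exp_neg_mul h₂,
    integral_Ici_exp_neg_mul h₃, integral_Ici_exp_neg_mul h₄]
  subst hθ hθ₀ hρ hρ₀
  field_simp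
  ring
end

section
/- Let 0 < α < r and σ, β, E, δ, I > 0, set θ := 2α(2r+δ)/((r−α)(r+α)(r+δ−α)(r+δ+α)) and ρ := 1/((r+δ+α)(r+α)), and define q(z,π) := βE·e^{−z}·(π/(1−π))^{σ²/(2α)}·( ((α−r)θ + 2αρ)·π − (α+r)ρ ) + r·I for (z,π) ∈ ℝ×(0,1). Then for every fixed z ∈ ℝ, the map π ↦ q(z,π) is continuous and strictly decreasing on (0,1), q(z,π) → r·I as π → 0⁺, and q(z,π) → −∞ as π → 1⁻. -/
open Filter Topology

/-- The odds ratio `x / (1 - x)` is strictly increasing on `(-∞, 1)`. -/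
theorem strictMonoOn_odds : StrictMonoOn (fun x : ℝ => x / (1 - x)) (Set.Iio 1) := by
  intro x hx y hy hxy
  simp only [Set.mem_Iio] at hx hy
  simp only
  rw [div_lt_div_iff₀ (by linarith) (by linarith)]
  linarith

/-- The odds ratio `x / (1 - x)` tends to `+∞` as `x → 1⁻`. -/
theorem tendsto_odds_atTop : Tendsto (fun x : ℝ => x / (1 - x)) (𝓝[<] 1) atTop := by
  have h : Tendsto (fun x : ℝ => 1 - x) (𝓝[<] 1) (𝓝[>] 0) := by
    refine tendsto_nhdsWithin_iff.2 ⟨?_, ?_⟩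
    · have : Tendsto (fun x : ℝ => 1 - x) (𝓝 1) (𝓝 (1 - 1)) :=
        Continuous.tendsto (by fun_prop) 1
      simpa using this.mono_left nhdsWithin_le_nhds
    · filter_upwards [self_mem_nhdsWithin] with x hx
      simpa using hx
  have hid : Tendsto (fun x : ℝ => x) (𝓝[<] 1) (𝓝 1) := nhdsWithin_le_nhds
  simpa [div_eq_mul_inv] using hid.pos_mul_atTop one_pos h.inv_tendsto_nhdsGT_zero

/-- The coefficient of the belief in the affine factor of the running gain simplifies to a
manifestly negative expression. -/
theorem gain_slope_eq {r α δ : ℝ} (hα : 0 < α) (hαr : α < r) (hδ : 0 < δ) :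
    (α - r) * (2 * α * (2 * r + δ) / ((r - α) * (r + α) * (r + δ - α) * (r + δ + α)))
      + 2 * α * (1 / ((r + δ + α) * (r + α)))
      = -(2 * α / ((r + δ - α) * (r + δ + α))) := by
  have h₁ : r - α ≠ 0 := by linarith
  have h₂ : r + α ≠ 0 := by linarith
  have h₃ : r + δ - α ≠ 0 := by linarith
  have h₄ : r + δ + α ≠ 0 := by linarith
  field_simp
  ring

section OddsPower

variable {c p a b : ℝ}

theorem continuousAt_odds_rpow_mul_affine (hp : 0 < p) (d : ℝ) {x : ℝ} (hx : x < 1) :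
    ContinuousAt (fun x : ℝ => c * (x / (1 - x)) ^ p * (a * x - b) + d) x := by
  have h : ContinuousAt (fun x : ℝ => x / (1 - x)) x :=
    continuousAt_id.div (by fun_prop) (by linarith)
  have h' := h.rpow_const (p := p) (Or.inr hp.le)
  fun_prop

theorem strictAntiOn_odds_rpow_mul_affine (hc : 0 < c) (hp : 0 < p) (ha : a < 0) (hb : 0 < b)
    (d : ℝ) :
    StrictAntiOn (fun x : ℝ => c * (x / (1 - x)) ^ p * (a * x - b) + d) (Set.Ioo 0 1) := by
  intro x hx y hy hxy
  have hodds : 0 < x / (1 - x) := div_pos hx.1 (by linarith [hx.2])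
  have hpow : (x / (1 - x)) ^ p < (y / (1 - y)) ^ p :=
    Real.rpow_lt_rpow hodds.le (strictMonoOn_odds hx.2 hy.2 hxy) hp
  have hpos : 0 < (x / (1 - x)) ^ p := Real.rpow_pos_of_pos hodds p
  have hax : a * x < 0 := mul_neg_of_neg_of_pos ha hx.1
  have hay : a * y < a * x := mul_lt_mul_of_neg_left hxy ha
  have hmul : (x / (1 - x)) ^ p * (b - a * x) < (y / (1 - y)) ^ p * (b - a * y) :=
    mul_lt_mul'' hpow (by linarith) hpos.le (by linarith)
  have := mul_lt_mul_of_pos_left hmul hc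
  simp only
  linarith

theorem tendsto_odds_rpow_mul_affine_atBot (hc : 0 < c) (hp : 0 < p) (hab : a < b) (d : ℝ) :
    Tendsto (fun x : ℝ => c * (x / (1 - x)) ^ p * (a * x - b) + d) (𝓝[<] 1) atBot := by
  have hpow := ((tendsto_rpow_atTop hp).comp tendsto_odds_atTop).const_mul_atTop hc
  have haff : Tendsto (fun x : ℝ => a * x - b) (𝓝[<] 1) (𝓝 (a * 1 - b)) :=
    Tendsto.mono_left (Continuous.tendsto (by fun_prop) 1) nhdsWithin_le_nhds
  exact tendsto_atBot_add_const_right _ d (hpow.atTop_mul_neg (by linarith) haff)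

end OddsPower

/-- Properties of the running-gain function `q(z,·)` in the belief variable: for every fixed
`z`, `π ↦ q(z,π)` is continuous and strictly decreasing on `(0,1)`, tends to `rI` as `π → 0⁺`
and to `−∞` as `π → 1⁻`. -/
theorem gain_properties_in_belief (r α σ β E δ I : ℝ)
    (hα : 0 < α) (hαr : α < r) (hσ : 0 < σ) (hβ : 0 < β) (hE : 0 < E)
    (hδ : 0 < δ) (hI : 0 < I)
    (θ ρ : ℝ)
    (hθ : θ = 2 * α * (2 * r + δ) / ((r - α) * (r + α) * (r + δ - α) * (r + δ + α)))
    (hρ : ρ = 1 / ((r + δ + α) * (r + α)))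
    (q : ℝ → ℝ → ℝ)
    (hq : ∀ z π, q z π = β * E * Real.exp (-z) * (π / (1 - π)) ^ (σ ^ 2 / (2 * α))
      * (((α - r) * θ + 2 * α * ρ) * π - (α + r) * ρ) + r * I) :
    ∀ z : ℝ,
      ContinuousOn (q z) (Set.Ioo 0 1)
      ∧ StrictAntiOn (q z) (Set.Ioo 0 1)
      ∧ Tendsto (q z) (𝓝[>] (0 : ℝ)) (𝓝 (r * I))
      ∧ Tendsto (q z) (𝓝[<] (1 : ℝ)) atBot := by
  intro z
  have hc : 0 < β * E * Real.exp (-z) := by positivity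
  have hp : 0 < σ ^ 2 / (2 * α) := by positivity
  have ha : (α - r) * θ + 2 * α * ρ < 0 := by
    rw [hθ, hρ, gain_slope_eq hα hαr hδ, neg_lt_zero]
    exact div_pos (by linarith) (mul_pos (by linarith) (by linarith))
  have hb : 0 < (α + r) * ρ := by
    have : 0 < r := hα.trans hαr
    rw [hρ]
    positivity
  rw [funext (hq z)]
  refine ⟨fun x hx => (continuousAt_odds_rpow_mul_affine hp _ hx.2).continuousWithinAt,
    strictAntiOn_odds_rpow_mul_affine hc hp ha hb _, ?_,
    tendsto_odds_rpow_mul_affine_atBot hc hp (ha.trans hb) _⟩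
  simpa [Real.zero_rpow hp.ne'] using
    (continuousAt_odds_rpow_mul_affine hp _ one_pos).tendsto.mono_left nhdsWithin_le_nhds
end

section
/- Let 0 < α < r and σ, β, E, δ, I > 0, set θ := 2α(2r+δ)/((r−α)(r+α)(r+δ−α)(r+δ+α)) and ρ := 1/((r+δ+α)(r+α)), and define q(z,π) := βE·e^{−z}·(π/(1−π))^{σ²/(2α)}·( ((α−r)θ + 2αρ)·π − (α+r)ρ ) + r·I for (z,π) ∈ ℝ×(0,1), and m(z) := inf{ π ∈ (0,1) : q(z,π) < 0 } for z ∈ ℝ. Then the function z ↦ m(z) is nondecreasing and continuous on ℝ. -/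
open Set in
/-- The level at which a continuous, strictly increasing, unbounded function on `[0, 1)` exceeds
an exponential target is monotone and continuous in the exponent. -/
theorem monotone_continuous_sInf_of_strictMonoOn {f : ℝ → ℝ} {K : ℝ} (hK : 0 < K)
    (hf : StrictMonoOn f (Ico 0 1)) (hc : ContinuousOn f (Ico 0 1)) (h0 : f 0 = 0)
    (hub : ∀ M, 0 < M → ∃ x ∈ Ioo (0 : ℝ) 1, M ≤ f x) (m : ℝ → ℝ)
    (hm : ∀ z, m z = sInf {x : ℝ | x ∈ Ioo (0 : ℝ) 1 ∧ K * Real.exp z < f x}) :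
    Monotone m ∧ Continuous m := by
  have level : ∀ z, ∀ p ∈ Ioo (0 : ℝ) 1, f p = K * Real.exp z → m z = p := by
    intro z p hp hfp
    have hset : {x : ℝ | x ∈ Ioo (0 : ℝ) 1 ∧ K * Real.exp z < f x} = Ioo p 1 := by
      ext x
      simp only [mem_ofPred_eq, ← hfp]
      constructor
      · rintro ⟨hx, hlt⟩
        exact ⟨(hf.lt_iff_lt (Ioo_subset_Ico_self hp) (Ioo_subset_Ico_self hx)).1 hlt, hx.2⟩
      · intro hx
        have hx' : x ∈ Ioo (0 : ℝ) 1 := ⟨hp.1.trans hx.1, hx.2⟩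
        exact ⟨hx', hf (Ioo_subset_Ico_self hp) (Ioo_subset_Ico_self hx') hx.1⟩
    rw [hm, hset, csInf_Ioo hp.2]
  have key : ∀ z, m z ∈ Ioo (0 : ℝ) 1 ∧ f (m z) = K * Real.exp z := by
    intro z
    have hM : 0 < K * Real.exp z := by positivity
    obtain ⟨b, hb, hMb⟩ := hub _ hM
    have hsub : Icc 0 b ⊆ Ico (0 : ℝ) 1 := fun x hx => ⟨hx.1, hx.2.trans_lt hb.2⟩
    obtain ⟨p, hp, hfp⟩ := intermediate_value_Icc hb.1.le (hc.mono hsub)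
      (show K * Real.exp z ∈ Icc (f 0) (f b) from ⟨h0.trans_le hM.le, hMb⟩)
    have hp0 : p ≠ 0 := by
      rintro rfl
      linarith
    have hp' : p ∈ Ioo (0 : ℝ) 1 := ⟨lt_of_le_of_ne hp.1 hp0.symm, (hsub hp).2⟩
    rw [level z p hp' hfp]
    exact ⟨hp', hfp⟩
  have hmono : Monotone m := by
    intro y z hyz
    rw [← hf.le_iff_le (Ioo_subset_Ico_self (key y).1) (Ioo_subset_Ico_self (key z).1),
      (key y).2, (key z).2]
    gcongr
  refine ⟨hmono, ?_⟩
  let g : ℝ → Ioo (0 : ℝ) 1 := fun z => ⟨m z, (key z).1⟩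
  have hg : Monotone g := fun y z hyz => hmono hyz
  have hsurj : Function.Surjective g := by
    rintro ⟨p, hp⟩
    have hfp : 0 < f p := h0 ▸ hf ⟨le_rfl, one_pos⟩ (Ioo_subset_Ico_self hp) hp.1
    refine ⟨Real.log (f p / K), Subtype.ext (level _ p hp ?_)⟩
    rw [Real.exp_log (by positivity)]
    field_simp
  exact continuous_subtype_val.comp (hg.continuous_of_surjective hsurj)

open Set in
/-- A positive power of the odds ratio times an increasing positive affine function is
continuous, strictly increasing and unbounded on `[0, 1)`. -/
theorem odds_rpow_mul_affine {k c a b : ℝ} (hk : 0 < k) (hc : 0 < c) (ha : 0 < a) (hb : 0 < b) :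
    StrictMonoOn (fun x : ℝ => k * (x / (1 - x)) ^ c * (a * x + b)) (Ico 0 1) ∧
    ContinuousOn (fun x : ℝ => k * (x / (1 - x)) ^ c * (a * x + b)) (Ico 0 1) ∧
    ∀ M, 0 < M → ∃ x ∈ Ioo (0 : ℝ) 1, M ≤ k * (x / (1 - x)) ^ c * (a * x + b) := by
  refine ⟨?_, ?_, ?_⟩
  · intro x hx y hy hxy
    have hx1 : 0 < 1 - x := by linarith [hx.2]
    have hy1 : 0 < 1 - y := by linarith [hy.2]
    have hx0 : 0 ≤ x := hx.1
    have hodds : x / (1 - x) < y / (1 - y) := by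
      rw [div_lt_div_iff₀ hx1 hy1]
      linarith
    have hpow : (x / (1 - x)) ^ c < (y / (1 - y)) ^ c :=
      Real.rpow_lt_rpow (by positivity) hodds hc
    have haff : a * x + b < a * y + b := by gcongr
    have : 0 ≤ (x / (1 - x)) ^ c := by positivity
    have : 0 ≤ a * x + b := by positivity
    show k * _ * _ < k * _ * _
    gcongr
  · have hodds : ContinuousOn (fun x : ℝ => x / (1 - x)) (Ico 0 1) :=
      continuousOn_id.div (by fun_prop) fun x hx => by linarith [hx.2]
    exact (continuousOn_const.mul (hodds.rpow_const fun _ _ => Or.inr hc.le)).mul (by fun_prop)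
  · intro M hM
    set t : ℝ := (M / (k * b)) ^ c⁻¹ with ht
    have ht0 : 0 < t := by positivity
    have htc : t ^ c = M / (k * b) := Real.rpow_inv_rpow (by positivity) hc.ne'
    refine ⟨t / (1 + t), ⟨by positivity, (div_lt_one (by positivity)).2 (by linarith)⟩, ?_⟩
    have hodds : t / (1 + t) / (1 - t / (1 + t)) = t := by
      have : 1 - t / (1 + t) = 1 / (1 + t) := by field_simp; ring
      rw [this]
      field_simp
    rw [hodds, htc]
    calc M = k * (M / (k * b)) * b := by field_simp
      _ ≤ k * (M / (k * b)) * (a * (t / (1 + t)) + b) := by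
        gcongr
        have : 0 ≤ a * (t / (1 + t)) := by positivity
        linarith


/-- The lower threshold function `m(z) = inf {π ∈ (0,1) : q(z,π) < 0}` is nondecreasing and
continuous on `ℝ`. -/
theorem lower_threshold_monotone_continuous (r α σ β E δ I : ℝ)
    (hα : 0 < α) (hαr : α < r) (hσ : 0 < σ) (hβ : 0 < β) (hE : 0 < E)
    (hδ : 0 < δ) (hI : 0 < I)
    (θ ρ : ℝ)
    (hθ : θ = 2 * α * (2 * r + δ) / ((r - α) * (r + α) * (r + δ - α) * (r + δ + α)))
    (hρ : ρ = 1 / ((r + δ + α) * (r + α)))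
    (q : ℝ → ℝ → ℝ)
    (hq : ∀ z π, q z π = β * E * Real.exp (-z) * (π / (1 - π)) ^ (σ ^ 2 / (2 * α))
      * (((α - r) * θ + 2 * α * ρ) * π - (α + r) * ρ) + r * I)
    (m : ℝ → ℝ)
    (hm : ∀ z, m z = sInf {π : ℝ | π ∈ Set.Ioo (0 : ℝ) 1 ∧ q z π < 0}) :
    Monotone m ∧ Continuous m := by
  have hr : 0 < r := hα.trans hαr
  have h1 : 0 < r - α := by linarith
  have h2 : 0 < r + α := by linarith
  have h3 : 0 < r + δ - α := by linarith
  have h4 : 0 < r + δ + α := by linarith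
  have hslope : (α - r) * θ + 2 * α * ρ = -(2 * α / ((r + δ + α) * (r + δ - α))) := by
    rw [hθ, hρ]
    field_simp
    ring
  have hρ0 : 0 < ρ := by rw [hρ]; positivity
  obtain ⟨hf, hc, hub⟩ := odds_rpow_mul_affine (k := β * E) (c := σ ^ 2 / (2 * α))
    (a := 2 * α / ((r + δ + α) * (r + δ - α))) (b := (α + r) * ρ)
    (by positivity) (by positivity) (by positivity) (by positivity)
  refine monotone_continuous_sInf_of_strictMonoOn (K := r * I) (by positivity) hf hc ?_ hub m ?_
  · have : σ ^ 2 / (2 * α) ≠ 0 := by positivity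
    simp [Real.zero_rpow this]
  · intro z
    rw [hm]
    congr 1
    ext π
    simp only [Set.mem_ofPred_eq, and_congr_right_iff]
    intro _
    rw [hq, hslope, Real.exp_neg, ← mul_lt_mul_iff_left₀ (Real.exp_pos z), zero_mul]
    have he := (Real.exp_pos z).ne'
    have key : ∀ P A B : ℝ, (β * E * (Real.exp z)⁻¹ * P * (-A * π - B) + r * I) * Real.exp z
        = r * I * Real.exp z - β * E * P * (A * π + B) := by
      intro P A B
      field_simp
      ring
    rw [key, sub_neg]
end

section
/- Let α, σ, r, β, E, δ, I > 0 with α < r. Set θ := 2α(2r+δ)/((r−α)(r+α)(r+δ−α)(r+δ+α)) and ρ := 1/((r+δ+α)(r+α)), and define F(z,π) := βE·e^{−z}·(π/(1−π))^{σ²/(2α)}·(θπ + ρ) − I and q(z,π) := βE·e^{−z}·(π/(1−π))^{σ²/(2α)}·( ((α−r)θ + 2αρ)·π − (α+r)ρ ) + r·I for (z,π) ∈ ℝ×(0,1). Then F is differentiable in z, twice differentiable in π, and for all (z,π) ∈ ℝ×(0,1): (σ²/2)·∂F/∂z(z,π) + (2α²/σ²)·π²(1−π)²·∂²F/∂π²(z,π)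 − r·F(z,π) = q(z,π). -/
theorem hasDerivAt_odds_rpow (a : ℝ) {p : ℝ} (hp : p ∈ Set.Ioo (0 : ℝ) 1) :
    HasDerivAt (fun x : ℝ => (x / (1 - x)) ^ a) ((p / (1 - p)) ^ a * (a / (p * (1 - p)))) p := by
  have hp0 : 0 < p := hp.1
  have hp1 : 0 < 1 - p := sub_pos.2 hp.2
  have h := ((hasDerivAt_id p).div ((hasDerivAt_id p).const_sub 1) hp1.ne').rpow_const
    (p := a) (Or.inl (div_pos hp0 hp1).ne')
  refine h.congr_deriv ?_
  simp only [id, Pi.div_apply]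
  rw [Real.rpow_sub_one (div_pos hp0 hp1).ne']
  field_simp
  ring

/-- First derivative of an affine function weighted by a power of the odds. -/
theorem hasDerivAt_odds_rpow_mul_affine (a θ ρ : ℝ) {p : ℝ} (hp : p ∈ Set.Ioo (0 : ℝ) 1) :
    HasDerivAt (fun x : ℝ => (x / (1 - x)) ^ a * (θ * x + ρ))
      ((p / (1 - p)) ^ a * (a / (p * (1 - p)) * (θ * p + ρ) + θ)) p := by
  have h := (hasDerivAt_odds_rpow a hp).mul (((hasDerivAt_id p).const_mul θ).add_const ρ)
  refine h.congr_deriv ?_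
  simp only [id]
  ring

/-- Second derivative of an affine function weighted by a power of the odds. -/
theorem hasDerivAt_deriv_odds_rpow_mul_affine (a θ ρ : ℝ) {p : ℝ} (hp : p ∈ Set.Ioo (0 : ℝ) 1) :
    HasDerivAt (fun x : ℝ => (x / (1 - x)) ^ a * (a / (x * (1 - x)) * (θ * x + ρ) + θ))
      ((p / (1 - p)) ^ a * (a * (a - 1 + 2 * p) * (θ * p + ρ) / (p ^ 2 * (1 - p) ^ 2)
        + 2 * a * θ / (p * (1 - p)))) p := by
  have hp0 : p ≠ 0 := hp.1.ne'
  have hp1 : 1 - p ≠ 0 := (sub_pos.2 hp.2).ne'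
  have hx := hasDerivAt_id p
  have h := (hasDerivAt_odds_rpow a hp).mul
    ((((hasDerivAt_const p a).div (hx.mul (hx.const_sub 1)) (mul_ne_zero hp0 hp1)).mul
      ((hx.const_mul θ).add_const ρ)).add_const θ)
  refine h.congr_deriv ?_
  simp only [id, Pi.div_apply, Pi.mul_apply]
  field_simp
  ring

/-- The stopping payoff `F(z,π) = βE e^{−z} (π/(1−π))^{σ²/(2α)} (θπ + ρ) − I` is
differentiable in `z` and twice differentiable in `π` on `ℝ × (0,1)`, and satisfies the
identity `(𝒢 − r)F = q`, i.e.
`(σ²/2) ∂F/∂z + (2α²/σ²) π²(1−π)² ∂²F/∂π² − rF = q`. -/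
theorem payoff_generator_identity (α σ r β E δ I : ℝ)
    (hα : 0 < α) (hσ : 0 < σ) (hr : 0 < r) (hβ : 0 < β) (hE : 0 < E)
    (hδ : 0 < δ) (hI : 0 < I) (hαr : α < r)
    (θ ρ : ℝ)
    (hθ : θ = 2 * α * (2 * r + δ) / ((r - α) * (r + α) * (r + δ - α) * (r + δ + α)))
    (hρ : ρ = 1 / ((r + δ + α) * (r + α)))
    (F q : ℝ → ℝ → ℝ)
    (hF : ∀ z π, F z π
      = β * E * Real.exp (-z) * (π / (1 - π)) ^ (σ ^ 2 / (2 * α)) * (θ * π + ρ) - I)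
    (hq : ∀ z π, q z π = β * E * Real.exp (-z) * (π / (1 - π)) ^ (σ ^ 2 / (2 * α))
      * (((α - r) * θ + 2 * α * ρ) * π - (α + r) * ρ) + r * I) :
    ∀ z : ℝ, ∀ π ∈ Set.Ioo (0 : ℝ) 1,
      DifferentiableAt ℝ (fun z' => F z' π) z
      ∧ DifferentiableAt ℝ (fun p => F z p) π
      ∧ DifferentiableAt ℝ (deriv (fun p => F z p)) π
      ∧ σ ^ 2 / 2 * deriv (fun z' => F z' π) z
          + 2 * α ^ 2 / σ ^ 2 * π ^ 2 * (1 - π) ^ 2 * deriv (deriv (fun p => F z p)) π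
          - r * F z π
        = q z π := by
  intro z π hπ
  have hp0 : π ≠ 0 := hπ.1.ne'
  have hp1 : 1 - π ≠ 0 := (sub_pos.2 hπ.2).ne'
  obtain ⟨a, ha⟩ : ∃ a, a = σ ^ 2 / (2 * α) := ⟨_, rfl⟩
  have hσa : σ ^ 2 = 2 * α * a := by rw [ha]; field_simp
  have ha0 : a ≠ 0 := by rw [ha]; positivity
  rw [← ha] at hF hq
  have hz : HasDerivAt (fun z' => F z' π)
      (-(β * E * Real.exp (-z) * (π / (1 - π)) ^ a * (θ * π + ρ))) z := by
    have h := (((((hasDerivAt_id z).neg.exp).const_mul (β * E)).mul_const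
      ((π / (1 - π)) ^ a)).mul_const (θ * π + ρ)).sub_const I
    refine (h.congr_deriv ?_).congr_of_eventuallyEq (.of_forall fun y => hF y π)
    simp only [id, Pi.neg_apply]
    ring
  have h1 : ∀ p ∈ Set.Ioo (0 : ℝ) 1, HasDerivAt (fun p => F z p) (β * E * Real.exp (-z) *
      ((p / (1 - p)) ^ a * (a / (p * (1 - p)) * (θ * p + ρ) + θ))) p := fun p hp =>
    (((hasDerivAt_odds_rpow_mul_affine a θ ρ hp).const_mul
      (β * E * Real.exp (-z))).sub_const I).congr_of_eventuallyEq
        (.of_forall fun y => by simp only [hF]; ring)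
  have h2 := ((hasDerivAt_deriv_odds_rpow_mul_affine a θ ρ hπ).const_mul
    (β * E * Real.exp (-z))).congr_of_eventuallyEq
      (f₁ := deriv (fun p => F z p))
      (Filter.eventuallyEq_of_mem (Ioo_mem_nhds hπ.1 hπ.2) fun p hp => (h1 p hp).deriv)
  refine ⟨hz.differentiableAt, (h1 π hπ).differentiableAt, h2.differentiableAt, ?_⟩
  rw [hz.deriv, h2.deriv, hF, hq, hσa]
  field_simp
  ring
end
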